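/- Let H be a set of bounded real-valued functions on a set X, let x₁,…,xₙ ∈ X, and let φᵢ : ℝ → ℝ, i = 1,…,n, be L-Lipschitz functions (not required to vanish at 0). Let ε₁,…,εₙ be i.i.d. Rademacher random variables (uniform on {−1,+1}). Then E_ε[ sup_{h∈H} (1/n) Σ_{i=1}^n εᵢ φᵢ(h(xᵢ)) ] ≤ L · E_ε[ sup_{h∈H} (1/n) Σ_{i=1}^n εᵢ h(xᵢ) ]. -/

import Mathlib

open MeasureTheory Finset

noncomputable section

/-- The ±1 real value of a Boolean label: `true ↦ 1`, `false ↦ -1`.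
We encode the label space {−1, 1} by `Bool`. -/
def sgn (b : Bool) : ℝ := if b then 1 else -1

/-- The Euclidean (L2) norm on ℝᵖ. -/
def l2norm {p : ℕ} (μ : Fin p → ℝ) : ℝ := Real.sqrt (∑ i, μ i ^ 2)

/-- The L1 norm on ℝᵖ. -/
def l1norm {p : ℕ} (μ : Fin p → ℝ) : ℝ := ∑ i, |μ i|

/-- The L∞ (supremum) norm on ℝᵖ. -/
def linfnorm {p : ℕ} (μ : Fin p → ℝ) : ℝ := ⨆ i, |μ i|

/-- The standard inner product on ℝᵖ. -/
def ip {p : ℕ} (μ v : Fin p → ℝ) : ℝ := ∑ i, μ i * v i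

/-- The K-space feature map `z(x,x') = (K₁(x,x'),…,K_p(x,x'))`. -/
def zmap {X : Type*} {p : ℕ} (K : Fin p → X → X → ℝ) (x x' : X) : Fin p → ℝ :=
  fun i => K i x x'

/-- The pairwise hinge loss `ℓ(μ, (x,y), (x',y')) = max(0, 1 − y y' ⟨μ, z(x,x')⟩)`. -/
def hinge {X : Type*} {p : ℕ} (K : Fin p → X → X → ℝ) (μ : Fin p → ℝ)
    (w w' : X × Bool) : ℝ :=
  max 0 (1 - sgn w.2 * sgn w'.2 * ip μ (zmap K w.1 w'.1))

/-- The empirical risk `R̂_S(μ) = (2/(n(n−1))) Σ_{1≤i<j≤n} ℓ(μ, (xᵢ,yᵢ), (xⱼ,yⱼ))`. -/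
def empRisk {X : Type*} {p n : ℕ} (K : Fin p → X → X → ℝ)
    (S : Fin n → X × Bool) (μ : Fin p → ℝ) : ℝ :=
  (2 / ((n : ℝ) * ((n : ℝ) - 1))) *
    ∑ i : Fin n, ∑ j : Fin n, if i < j then hinge K μ (S i) (S j) else 0

/-- The true risk `R(μ) = E_{((x,y),(x',y')) ~ D×D}[max(0, 1 − y y' ⟨μ, z(x,x')⟩)]`. -/
def trueRisk {X : Type*} [MeasurableSpace X] {p : ℕ} (K : Fin p → X → X → ℝ)
    (D : Measure (X × Bool)) (μ : Fin p → ℝ) : ℝ :=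
  ∫ w, hinge K μ w.1 w.2 ∂(D.prod D)

/-- Expectation over m i.i.d. Rademacher random variables (uniform on {−1,+1}),
encoded by Booleans mapped to ±1 via `sgn`. -/
def radE {m : ℕ} (f : (Fin m → Bool) → ℝ) : ℝ :=
  (∑ ε : Fin m → Bool, f ε) / 2 ^ m

/-- Symmetrized suprema only grow when the increments of `f` are dominated by those of `g`. -/
theorem iSup_add_add_iSup_sub_le {ι : Type*} [Nonempty ι] {u f g : ι → ℝ}
    (hfg : ∀ a b, |f a - f b| ≤ |g a - g b|)
    (hadd : BddAbove (Set.range fun a => u a + g a))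
    (hsub : BddAbove (Set.range fun a => u a - g a)) :
    (⨆ a, (u a + f a)) + ⨆ a, (u a - f a) ≤ (⨆ a, (u a + g a)) + ⨆ a, (u a - g a) := by
  rw [← le_sub_iff_add_le]
  refine ciSup_le fun a => ?_
  rw [le_sub_comm]
  refine ciSup_le fun b => ?_
  have h₁ := le_ciSup hadd a
  have h₂ := le_ciSup hsub a
  have h₃ := le_ciSup hadd b
  have h₄ := le_ciSup hsub b
  have h₅ := (le_abs_self _).trans (hfg a b)
  rcases abs_cases (g a - g b) with h | h <;> linarith

theorem abs_sgn (b : Bool) : |sgn b| = 1 := by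
  cases b <;> simp [sgn]

theorem abs_add_sum_sgn_mul_le {n : ℕ} {ι : Type*} {c : ι → ℝ} {g : Fin n → ι → ℝ} {C : ℝ}
    {D : Fin n → ℝ} (hc : ∀ a, |c a| ≤ C) (hg : ∀ i a, |g i a| ≤ D i) (ε : Fin n → Bool)
    (a : ι) : |c a + ∑ i, sgn (ε i) * g i a| ≤ C + ∑ i, D i := by
  refine (abs_add_le _ _).trans (add_le_add (hc a) ((abs_sum_le_sum_abs _ _).trans ?_))
  refine sum_le_sum fun i _ => ?_
  rw [abs_mul, abs_sgn, one_mul]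
  exact hg i a

theorem sum_fin_succ_bool {n : ℕ} (F : (Fin (n + 1) → Bool) → ℝ) :
    ∑ ε, F ε = ∑ b : Bool, ∑ ε : Fin n → Bool, F (Fin.cons b ε) := by
  rw [← (Fin.consEquiv fun _ : Fin (n + 1) => Bool).sum_comp, Fintype.sum_prod_type]
  rfl

/-- Contraction for Rademacher sums: replacing `f` by a `g` with larger increments
increases the summed suprema, for any bounded offset `c`. -/
theorem sum_iSup_add_sum_sgn_mul_le {n : ℕ} {ι : Type*} [Nonempty ι] {c : ι → ℝ}
    {f g : Fin n → ι → ℝ} {C : ℝ} {A D : Fin n → ℝ} (hc : ∀ a, |c a| ≤ C)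
    (hf : ∀ i a, |f i a| ≤ A i) (hg : ∀ i a, |g i a| ≤ D i)
    (hfg : ∀ i a b, |f i a - f i b| ≤ |g i a - g i b|) :
    ∑ ε : Fin n → Bool, ⨆ a, (c a + ∑ i, sgn (ε i) * f i a) ≤
      ∑ ε : Fin n → Bool, ⨆ a, (c a + ∑ i, sgn (ε i) * g i a) := by
  induction n generalizing c C with
  | zero => simp
  | succ n ih =>
    have hstep (b : Bool) := ih (c := fun a => c a + sgn b * f 0 a) (C := C + A 0)
      (f := fun i => f i.succ) (g := fun i => g i.succ) (A := fun i => A i.succ)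
      (D := fun i => D i.succ)
      (fun a => (abs_add_le _ _).trans (add_le_add (hc a) (by
        rw [abs_mul, abs_sgn, one_mul]; exact hf 0 a)))
      (fun i => hf i.succ) (fun i => hg i.succ) (fun i => hfg i.succ)
    rw [sum_fin_succ_bool, sum_fin_succ_bool]
    simp only [Fin.sum_univ_succ, Fin.cons_zero, Fin.cons_succ, ← add_assoc]
    refine (sum_le_sum fun b _ => hstep b).trans ?_
    simp only [Fintype.sum_bool, ← sum_add_distrib]
    refine sum_le_sum fun ε _ => ?_
    have hbound (a : ι) := abs_add_sum_sgn_mul_le hc (fun i => hg i.succ) ε a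
    have key := iSup_add_add_iSup_sub_le
      (u := fun a => c a + ∑ i, sgn (ε i) * g i.succ a) (hfg 0)
      ⟨C + ∑ i : Fin n, D i.succ + D 0, by
        rintro _ ⟨a, rfl⟩
        exact add_le_add ((le_abs_self _).trans (hbound a)) ((le_abs_self _).trans (hg 0 a))⟩
      ⟨C + ∑ i : Fin n, D i.succ + D 0, by
        rintro _ ⟨a, rfl⟩
        simp only [sub_eq_add_neg]
        exact add_le_add ((le_abs_self _).trans (hbound a)) ((neg_le_abs _).trans (hg 0 a))⟩
    simpa only [sgn, if_true, Bool.false_eq_true, if_false, one_mul, neg_one_mul,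
      sub_eq_add_neg, add_right_comm] using key

/-- Rademacher contraction inequality for (possibly non-vanishing at 0)
L-Lipschitz wrapper functions, for empirical Rademacher averages. -/
theorem stmt4 {X : Type*} {n : ℕ} (H : Set (X → ℝ))
    (hb : ∃ C : ℝ, ∀ h ∈ H, ∀ x, |h x| ≤ C)
    (x : Fin n → X) (L : ℝ) (hL : 0 ≤ L)
    (φ : Fin n → ℝ → ℝ)
    (hφ : ∀ i, ∀ a b : ℝ, |φ i a - φ i b| ≤ L * |a - b|) :
    radE (fun ε : Fin n → Bool =>
        ⨆ h : H, (1 / (n : ℝ)) * ∑ i, sgn (ε i) * φ i (h.1 (x i))) ≤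
      L * radE (fun ε : Fin n → Bool =>
        ⨆ h : H, (1 / (n : ℝ)) * ∑ i, sgn (ε i) * h.1 (x i)) := by
  obtain ⟨C, hC⟩ := hb
  rcases isEmpty_or_nonempty H with hH | ⟨⟨h₀⟩⟩
  · simp [radE]
  have : Nonempty H := ⟨h₀⟩
  have hinc (i : Fin n) (a b : H) :
      |φ i (a.1 (x i)) - φ i (b.1 (x i))| ≤ |L * a.1 (x i) - L * b.1 (x i)| := by
    rw [← mul_sub, abs_mul, abs_of_nonneg hL]
    exact hφ i _ _
  have hg (i : Fin n) (a : H) : |L * a.1 (x i)| ≤ L * C := by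
    rw [abs_mul, abs_of_nonneg hL]
    exact mul_le_mul_of_nonneg_left (hC a.1 a.2 _) hL
  have hf (i : Fin n) (a : H) : |φ i (a.1 (x i))| ≤ |φ i (h₀.1 (x i))| + (L * C + L * C) := by
    have h₁ := abs_sub_abs_le_abs_sub (φ i (a.1 (x i))) (φ i (h₀.1 (x i)))
    have h₂ := abs_sub (L * a.1 (x i)) (L * h₀.1 (x i))
    linarith [hinc i a h₀, hg i a, hg i h₀]
  have key := sum_iSup_add_sum_sgn_mul_le (c := fun _ : H => 0) (C := 0) (by simp) hf hg hinc
  simp only [zero_add, mul_left_comm _ L, ← mul_sum, ← Real.mul_iSup_of_nonneg hL] at key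
  have hn : 0 ≤ 1 / (n : ℝ) := by positivity
  simp only [radE, ← Real.mul_iSup_of_nonneg hn, ← mul_sum]
  rw [← mul_div_assoc, mul_left_comm]
  gcongr
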